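/- Let d ∈ ℕ, k ≤ d, let m be a random freeze mask with k active coordinates (freeze rate r = 1 − k/d), let v ∈ ℝ^d be a fixed vector, let C > 0, and let p̃ be a probability measure on ℝ^d. Then E_m[ p̃({ξ ∈ ℝ^d : ‖m ⊙ ξ‖ < C/4})·min(‖m ⊙ v‖, 3C/4)·‖m ⊙ v‖ ] ≥ (1 − r)·p̃({ξ ∈ ℝ^d : ‖ξ‖ < C/4})·min(‖v‖, 3C/4)·‖v‖. -/

import Mathlib

open MeasureTheory ProbabilityTheory
open scoped RealInnerProductSpace

/-- Build a vector of `EuclideanSpace ℝ (Fin d)` from its coordinates. -/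
noncomputable def toE {d : ℕ} (f : Fin d → ℝ) : EuclideanSpace ℝ (Fin d) :=
  (WithLp.equiv 2 (Fin d → ℝ)).symm f

/-- The set of freeze masks on `{0,1}^d` with exactly `k` active coordinates,
represented by the subset of active coordinates. A *random freeze mask with `k` active
coordinates* is uniformly distributed on this finite set, so its expectations are
finite averages over `masks d k`. -/
def masks (d k : ℕ) : Finset (Finset (Fin d)) := Finset.powersetCard k Finset.univ

/-- The `{0,1}`-valued mask vector associated to a set `s` of active coordinates. -/
def maskFun {d : ℕ} (s : Finset (Fin d)) : Fin d → ℝ := fun i => if i ∈ s then 1 else 0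

/-- Coordinatewise (Hadamard) product `m ⊙ u` of the mask of `s` with a vector `u ∈ ℝ^d`. -/
noncomputable def maskMul {d : ℕ} (s : Finset (Fin d)) (u : EuclideanSpace ℝ (Fin d)) :
    EuclideanSpace ℝ (Fin d) := toE fun i => maskFun s i * u i

theorem aux_norm_sq {d : ℕ} (s : Finset (Fin d)) (u : EuclideanSpace ℝ (Fin d)) :
    ‖maskMul s u‖ ^ 2 = ∑ i, (if i ∈ s then (u i) ^ 2 else 0) := by
  rw [EuclideanSpace.norm_sq_eq]
  refine Finset.sum_congr rfl fun i _ => ?_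
  have : (maskMul s u) i = maskFun s i * u i := rfl
  rw [this, maskFun]
  split_ifs <;> simp

theorem aux_norm_le {d : ℕ} (s : Finset (Fin d)) (u : EuclideanSpace ℝ (Fin d)) :
    ‖maskMul s u‖ ≤ ‖u‖ := by
  refine (sq_le_sq₀ (norm_nonneg _) (norm_nonneg _)).mp ?_
  rw [aux_norm_sq, EuclideanSpace.norm_sq_eq]
  refine Finset.sum_le_sum fun i _ => ?_
  split_ifs
  · simp
  · positivity

theorem aux_count {d k : ℕ} (hk : k ≤ d) (i : Fin d) :
    (d : ℝ) * (((masks d k).filter (fun s => i ∈ s)).card : ℝ) = k * ((masks d k).card : ℝ) := by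
  have h1 : (masks d k).filter (fun s => ¬ i ∈ s) =
      Finset.powersetCard k (Finset.univ.erase i) := by
    ext s
    simp only [masks, Finset.mem_filter, Finset.mem_powersetCard, Finset.subset_univ, true_and,
      Finset.subset_erase]
    tauto
  have h2 := Finset.card_filter_add_card_filter_not (s := masks d k) (fun s => i ∈ s)
  rw [h1, Finset.card_powersetCard, Finset.card_erase_of_mem (Finset.mem_univ i),
    Finset.card_univ, Fintype.card_fin] at h2
  have h3 : (masks d k).card = d.choose k := by simp [masks]
  rw [h3] at h2 ⊢
  obtain ⟨n, rfl⟩ : ∃ n, d = n + 1 := ⟨d - 1, by have := i.2; omega⟩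
  have h4 := Nat.choose_mul_succ_eq n k
  simp only [Nat.add_sub_cancel] at h2
  have h2' : (((masks (n+1) k).filter (fun s => i ∈ s)).card : ℝ) + (n.choose k : ℝ)
      = ((n+1).choose k : ℝ) := by exact_mod_cast h2
  have h4' : (n.choose k : ℝ) * ((n + 1 : ℕ) : ℝ) =
      ((n+1).choose k : ℝ) * (((n + 1 : ℕ) : ℝ) - k) := by
    rw [← Nat.cast_sub hk]; exact_mod_cast h4
  linear_combination ((n + 1 : ℕ) : ℝ) * h2' - h4'

theorem aux_sum {d k : ℕ} (hk : k ≤ d) (v : EuclideanSpace ℝ (Fin d)) :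
    (d : ℝ) * ∑ s ∈ masks d k, ‖maskMul s v‖ ^ 2 = k * ((masks d k).card : ℝ) * ‖v‖ ^ 2 := by
  simp_rw [aux_norm_sq]
  rw [Finset.sum_comm, EuclideanSpace.norm_sq_eq, Finset.mul_sum, Finset.mul_sum]
  refine Finset.sum_congr rfl fun i _ => ?_
  rw [← Finset.sum_filter, Finset.sum_const, nsmul_eq_mul, ← mul_assoc, aux_count hk i]
  simp

theorem aux_min {a b c : ℝ} (ha : 0 ≤ a) (hab : a ≤ b) (hc : 0 < c) :
    a * min b c ≤ min a c * b := by
  rcases le_total a c with h | h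
  · rw [min_eq_left h]
    exact mul_le_mul_of_nonneg_left (min_le_left _ _) ha
  · rw [min_eq_right h, min_eq_right (h.trans hab)]
    nlinarith

/-- combined lower bound in the proof of the paper's Theorem 2. For a
uniformly random freeze mask `m` with `k` active coordinates (freeze rate `r = 1 − k/d`),
a fixed `v ∈ ℝ^d`, `C > 0` and a probability measure `p̃` on `ℝ^d`,
`E_m[p̃({ξ : ‖m ⊙ ξ‖ < C/4})·min(‖m ⊙ v‖, 3C/4)·‖m ⊙ v‖]
  ≥ (1 − r)·p̃({ξ : ‖ξ‖ < C/4})·min(‖v‖, 3C/4)·‖v‖`. -/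
theorem expected_mask_prob_clipped_ge {d k : ℕ} (hk : k ≤ d) (r : ℝ)
    (hr : r = 1 - (k : ℝ) / d) (v : EuclideanSpace ℝ (Fin d)) (C : ℝ) (hC : 0 < C)
    (p : Measure (EuclideanSpace ℝ (Fin d))) [IsProbabilityMeasure p] :
    (1 - r) * (p {ξ | ‖ξ‖ < C / 4}).toReal * (min ‖v‖ (3 * C / 4) * ‖v‖) ≤
      ((masks d k).card : ℝ)⁻¹ *
        ∑ s ∈ masks d k,
          (p {ξ | ‖maskMul s ξ‖ < C / 4}).toReal *
            (min ‖maskMul s v‖ (3 * C / 4) * ‖maskMul s v‖) := by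
  have hN : (0 : ℝ) < ((masks d k).card : ℝ) := by
    have : (masks d k).card = d.choose k := by simp [masks]
    rw [this]; exact_mod_cast Nat.choose_pos hk
  have hr' : 1 - r = (k : ℝ) / d := by rw [hr]; ring
  rw [hr']
  rcases (norm_nonneg v).eq_or_lt with hv | hv
  · rw [← hv, mul_zero, mul_zero]
    refine mul_nonneg (by positivity) (Finset.sum_nonneg fun s _ => ?_)
    positivity
  have hd : (0 : ℝ) < d := by
    rcases Nat.eq_zero_or_pos d with h | h
    · subst h
      rw [Subsingleton.elim v 0, norm_zero] at hv
      exact absurd hv (lt_irrefl _)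
    · exact_mod_cast h
  set P := (p {ξ | ‖ξ‖ < C / 4}).toReal with hP
  have hP0 : 0 ≤ P := ENNReal.toReal_nonneg
  have key : ∀ s ∈ masks d k, ‖maskMul s v‖ ^ 2 * (P * min ‖v‖ (3 * C / 4) / ‖v‖) ≤
      (p {ξ | ‖maskMul s ξ‖ < C / 4}).toReal *
            (min ‖maskMul s v‖ (3 * C / 4) * ‖maskMul s v‖) := by
    intro s _
    have h1 : P ≤ (p {ξ | ‖maskMul s ξ‖ < C / 4}).toReal := by
      apply ENNReal.toReal_mono (measure_ne_top _ _)
      exact measure_mono fun ξ hξ => lt_of_le_of_lt (aux_norm_le s ξ) hξ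
    have h2 := aux_min (norm_nonneg (maskMul s v)) (aux_norm_le s v)
      (show 0 < 3 * C / 4 by positivity)
    have h3 : ‖maskMul s v‖ ^ 2 * (P * min ‖v‖ (3 * C / 4) / ‖v‖) ≤
        P * (min ‖maskMul s v‖ (3 * C / 4) * ‖maskMul s v‖) := by
      rw [← mul_div_assoc, div_le_iff₀ hv]
      have := mul_le_mul_of_nonneg_left h2 (mul_nonneg hP0 (norm_nonneg (maskMul s v)))
      linarith
    exact h3.trans (mul_le_mul_of_nonneg_right h1 (by positivity))
  refine le_trans (le_of_eq ?_)
    (mul_le_mul_of_nonneg_left (Finset.sum_le_sum key) (inv_nonneg.mpr hN.le))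
  rw [← Finset.sum_mul]
  have hs : ∑ s ∈ masks d k, ‖maskMul s v‖ ^ 2 =
      k * ((masks d k).card : ℝ) * ‖v‖ ^ 2 / d := by
    rw [eq_div_iff hd.ne', ← aux_sum hk v]; ring
  rw [hs]
  field_simp
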